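/- Let ν be a symmetric Lévy measure on ℝ \ {0} (i.e., ν is invariant under x ↦ −x and ∫ min(1, x²) dν < ∞) with ν((0, ε)) > 0 for every ε > 0. Suppose η(r) := ∫_{0<x≤r} x² dν(x) satisfies ∫_0^1 r/η(r) dr < ∞. Then the infinitely divisible distribution with characteristic function exp(∫_ℝ (cos(ux) − 1) dν(x)) is absolutely continuous with respect to Lebesgue measure. -/

import Mathlib

open MeasureTheory Filter Set

/-- The real part of the characteristic function of a measure on the line. -/
noncomputable def cosTransform (m : Measure ℝ) (u : ℝ) : ℝ := ∫ x, Real.cos (u * x) ∂m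

lemma integrable_cos_mul (m : Measure ℝ) [IsFiniteMeasure m] (u : ℝ) :
    Integrable (fun x => Real.cos (u * x)) m :=
  Integrable.of_bound (by fun_prop) 1 (ae_of_all _ fun x => Real.abs_cos_le_one _)

lemma integrable_exp_mul_I (m : Measure ℝ) [IsFiniteMeasure m] (u : ℝ) :
    Integrable (fun x : ℝ => Complex.exp (u * x * Complex.I)) m :=
  Integrable.of_bound (by fun_prop) 1 (ae_of_all _ fun x => by
    rw [← Complex.ofReal_mul, Complex.norm_exp_ofReal_mul_I])

lemma continuous_cosTransform (m : Measure ℝ) [IsFiniteMeasure m] :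
    Continuous (cosTransform m) :=
  continuous_of_dominated (bound := fun _ => 1) (fun u => by fun_prop)
    (fun u => ae_of_all _ fun x => Real.abs_cos_le_one _) (integrable_const _)
    (ae_of_all _ fun x => by fun_prop)

lemma re_charFun_eq_cosTransform (m : Measure ℝ) [IsFiniteMeasure m] (u : ℝ) :
    (charFun m u).re = cosTransform m u := by
  have h := integrable_exp_mul_I m u
  rw [charFun_apply_real, cosTransform]
  refine (integral_re h).symm.trans (integral_congr_ae (ae_of_all _ fun x => ?_))
  simp [← Complex.ofReal_mul, Complex.exp_ofReal_mul_I_re]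

lemma charFun_eq_cosTransform_of_symmetric (m : Measure ℝ) [IsFiniteMeasure m]
    (hsym : m.map (fun x => -x) = m) (u : ℝ) : charFun m u = (cosTransform m u : ℂ) := by
  have h : charFun m (-u) = charFun m u := by
    conv_rhs => rw [← hsym, show (fun x : ℝ => -x) = fun x => (-1 : ℝ) * x by simp,
      charFun_map_mul]
    simp
  rw [charFun_neg] at h
  rw [← re_charFun_eq_cosTransform]
  exact (Complex.conj_eq_iff_re.mp h).symm

/-- Convolution powers of a measure. -/
noncomputable def convPow (n : Measure ℝ) : ℕ → Measure ℝ
  | 0 => Measure.dirac 0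
  | k + 1 => n.conv (convPow n k)

instance isFiniteMeasure_convPow (n : Measure ℝ) [IsFiniteMeasure n] (k : ℕ) :
    IsFiniteMeasure (convPow n k) := by
  induction k with
  | zero => rw [convPow]; infer_instance
  | succ k ih => rw [convPow]; infer_instance

lemma charFun_convPow (n : Measure ℝ) [IsFiniteMeasure n] (k : ℕ) (u : ℝ) :
    charFun (convPow n k) u = charFun n u ^ k := by
  induction k with
  | zero => simp [convPow, charFun_dirac]
  | succ k ih => rw [convPow, charFun_conv, ih, pow_succ']

lemma measure_univ_convPow (n : Measure ℝ) [IsFiniteMeasure n] (k : ℕ) :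
    (convPow n k) univ = ENNReal.ofReal (n.real univ ^ k) := by
  have h := charFun_convPow n k 0
  simp only [charFun_zero] at h
  rw [← ofReal_measureReal]
  congr 1
  exact_mod_cast h

/-- The exponential of a finite measure in the convolution algebra. -/
lemma exists_charFun_eq_exp_charFun (n : Measure ℝ) [IsFiniteMeasure n] :
    ∃ m : Measure ℝ, IsFiniteMeasure m ∧ ∀ u, charFun m u = Complex.exp (charFun n u) := by
  let w : ℕ → Measure ℝ := fun k => ENNReal.ofReal ((k.factorial : ℝ)⁻¹) • convPow n k
  have hfin : IsFiniteMeasure (Measure.sum w) := by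
    constructor
    rw [Measure.sum_apply _ MeasurableSet.univ]
    have h1 : ∀ k, w k univ = ENNReal.ofReal (n.real univ ^ k / (k.factorial : ℝ)) := by
      intro k
      simp only [w, Measure.smul_apply, smul_eq_mul, measure_univ_convPow]
      rw [← ENNReal.ofReal_mul (by positivity)]
      congr 1
      ring
    simp_rw [h1]
    rw [← ENNReal.ofReal_tsum_of_nonneg (fun k => by positivity)
      (Real.summable_pow_div_factorial _)]
    exact ENNReal.ofReal_lt_top
  refine ⟨Measure.sum w, hfin, fun u => ?_⟩
  have hI := integrable_exp_mul_I (Measure.sum w) u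
  have h2 := hasSum_integral_measure hI
  have h3 := NormedSpace.exp_series_hasSum_exp' (𝕂 := ℂ) (charFun n u)
  rw [← Complex.exp_eq_exp_ℂ] at h3
  rw [charFun_apply_real]
  refine h2.unique ?_
  refine (congrArg (fun f => HasSum f _) (funext fun k => ?_)).mpr h3
  rw [integral_smul_measure, ← charFun_apply_real, charFun_convPow,
    ENNReal.toReal_ofReal (by positivity), Complex.real_smul]
  simp

lemma exists_cosTransform_eq_exp (n : Measure ℝ) [IsFiniteMeasure n]
    (hsym : n.map (fun x => -x) = n) :
    ∃ m : Measure ℝ, IsFiniteMeasure m ∧ ∀ u, cosTransform m u = Real.exp (cosTransform n u) := by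
  obtain ⟨m, hm, h⟩ := exists_charFun_eq_exp_charFun n
  refine ⟨m, hm, fun u => ?_⟩
  rw [← re_charFun_eq_cosTransform, h, charFun_eq_cosTransform_of_symmetric n hsym,
    ← Complex.ofReal_exp, Complex.ofReal_re]

lemma cos_le_one_sub_sq_div_five {x : ℝ} (h : |x| ≤ 3) : Real.cos x ≤ 1 - x ^ 2 / 5 := by
  have h1 := Real.cos_le_one_sub_mul_cos_sq (h.trans Real.pi_gt_three.le)
  have h2 : (1 : ℝ) / 5 ≤ 2 / Real.pi ^ 2 := by
    rw [div_le_div_iff₀ (by norm_num) (by positivity)]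
    nlinarith [Real.pi_lt_d2, Real.pi_pos]
  nlinarith [mul_le_mul_of_nonneg_right h2 (sq_nonneg x)]

/-- The cosine transform of the triangle function of height and half-width `a`, up to a
factor `2`. -/
noncomputable def triangleKernel (a x : ℝ) : ℝ := ∫ v in 0..a, (a - v) * Real.cos (v * x)

lemma triangleKernel_of_ne_zero (a : ℝ) {x : ℝ} (hx : x ≠ 0) :
    triangleKernel a x = (1 - Real.cos (a * x)) / x ^ 2 := by
  have h : ∀ v ∈ uIcc 0 a, HasDerivAt
      (fun v => (a - v) * (Real.sin (v * x) / x) - Real.cos (v * x) / x ^ 2)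
      ((a - v) * Real.cos (v * x)) v := by
    intro v _
    have h1 : HasDerivAt (fun v : ℝ => v * x) x v := by
      simpa using (hasDerivAt_id v).mul_const x
    have h2 := ((((hasDerivAt_id v).const_sub a).mul (h1.sin.div_const x))).sub
      (h1.cos.div_const (x ^ 2))
    refine h2.congr_deriv ?_
    simp only [id]
    field_simp
    ring
  rw [triangleKernel, intervalIntegral.integral_eq_sub_of_hasDerivAt h
    (Continuous.intervalIntegrable (by fun_prop) _ _)]
  simp
  ring

lemma triangleKernel_zero_right (a : ℝ) : triangleKernel a 0 = a ^ 2 / 2 := by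
  have h : ∫ v in 0..a, (a - v) = a ^ 2 / 2 := by
    rw [intervalIntegral.integral_sub (by simp) (by simp), integral_id]
    simp
    ring
  simpa [triangleKernel] using h

lemma triangleKernel_nonneg (a x : ℝ) : 0 ≤ triangleKernel a x := by
  rcases eq_or_ne x 0 with rfl | hx
  · rw [triangleKernel_zero_right]; positivity
  · rw [triangleKernel_of_ne_zero a hx]
    have := Real.cos_le_one (a * x)
    exact div_nonneg (by linarith) (by positivity)

lemma triangleKernel_le (a x : ℝ) : triangleKernel a x ≤ a ^ 2 / 2 := by
  rcases eq_or_ne x 0 with rfl | hx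
  · rw [triangleKernel_zero_right]
  · rw [triangleKernel_of_ne_zero a hx, div_le_iff₀ (by positivity)]
    have := Real.one_sub_sq_div_two_le_cos (x := a * x)
    nlinarith

lemma sq_div_five_le_triangleKernel {a x : ℝ} (h : |a * x| ≤ 1) :
    a ^ 2 / 5 ≤ triangleKernel a x := by
  rcases eq_or_ne x 0 with rfl | hx
  · rw [triangleKernel_zero_right]; nlinarith [sq_nonneg a]
  · rw [triangleKernel_of_ne_zero a hx, le_div_iff₀ (by positivity)]
    have h1 := cos_le_one_sub_sq_div_five (x := a * x) (by linarith)
    nlinarith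

lemma continuous_triangleKernel (a : ℝ) : Continuous (triangleKernel a) :=
  intervalIntegral.continuous_parametric_intervalIntegral_of_continuous' (by fun_prop) _ _

lemma integrable_triangleKernel_sub (m : Measure ℝ) [IsFiniteMeasure m] (a y : ℝ) :
    Integrable (fun x => triangleKernel a (x - y)) m :=
  Integrable.of_bound
    ((continuous_triangleKernel a).comp (continuous_id.sub continuous_const)).aestronglyMeasurable
    (a ^ 2 / 2) (ae_of_all _ fun x => by
      rw [Real.norm_of_nonneg (triangleKernel_nonneg _ _)]
      exact triangleKernel_le _ _)

lemma intervalIntegral_integral_mul_cos_swap (m : Measure ℝ) [IsFiniteMeasure m] {c : ℝ → ℝ}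
    (hc : Continuous c) {C : ℝ} (hC : ∀ x, |c x| ≤ C)
    {a y : ℝ} (ha : 0 ≤ a) :
    ∫ v in 0..a, (a - v) * ∫ x, c x * Real.cos (v * (x - y)) ∂m
      = ∫ x, c x * triangleKernel a (x - y) ∂m := by
  simp_rw [triangleKernel, ← intervalIntegral.integral_const_mul, ← integral_const_mul,
    intervalIntegral.integral_of_le ha]
  rw [integral_integral_swap]
  · refine integral_congr_ae (ae_of_all _ fun x => integral_congr_ae (ae_of_all _ fun v => ?_))
    simp only
    ring
  · refine Integrable.of_bound (C := a * C) (Continuous.aestronglyMeasurable (by fun_prop)) ?_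
    have : ∀ᵐ v ∂(volume.restrict (Ioc 0 a)), v ∈ Ioc 0 a := ae_restrict_mem measurableSet_Ioc
    have h2 := (Measure.quasiMeasurePreserving_fst (μ := volume.restrict (Ioc 0 a)) (ν := m)).ae this
    filter_upwards [h2] with p hp
    simp only [Function.uncurry, Real.norm_eq_abs, abs_mul]
    have hC0 : 0 ≤ C := (abs_nonneg _).trans (hC 0)
    have h3 : |a - p.1| ≤ a := by rw [abs_le]; constructor <;> linarith [hp.1, hp.2]
    have h4 : |c p.2| * |Real.cos (p.1 * (p.2 - y))| ≤ C * 1 :=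
      mul_le_mul (hC _) (Real.abs_cos_le_one _) (abs_nonneg _) hC0
    calc _ ≤ a * (C * 1) := mul_le_mul h3 h4 (by positivity) ha
      _ = a * C := by ring

/-- Positive definiteness, integrated against a triangle function. -/
lemma intervalIntegral_shift_cosTransform_le (m : Measure ℝ) [IsFiniteMeasure m] {a : ℝ}
    (ha : 0 ≤ a) (b : ℝ) :
    ∫ v in 0..a, (a - v) * (cosTransform m (b + v) + cosTransform m (b - v))
      ≤ ∫ v in 0..a, (a - v) * (2 * cosTransform m v) := by
  have hF := continuous_cosTransform m
  rw [← sub_nonneg, ← intervalIntegral.integral_sub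
    (Continuous.intervalIntegrable (by fun_prop) _ _)
    (Continuous.intervalIntegrable (by fun_prop) _ _)]
  have h : ∀ v, (a - v) * (2 * cosTransform m v)
      - (a - v) * (cosTransform m (b + v) + cosTransform m (b - v))
      = (a - v) * ∫ x, (2 * (1 - Real.cos (b * x))) * Real.cos (v * (x - 0)) ∂m := by
    intro v
    have i1 := integrable_cos_mul m v
    have i2 := integrable_cos_mul m (b + v)
    have i3 := integrable_cos_mul m (b - v)
    have i4 : Integrable (fun x => Real.cos ((b + v) * x) + Real.cos ((b - v) * x)) m :=
      i2.add i3
    rw [← mul_sub]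
    simp only [cosTransform]
    rw [← integral_const_mul, ← integral_add i2 i3,
      ← integral_sub (i1.const_mul 2) i4]
    congr 2
    ext x
    simp only [add_mul, sub_mul, Real.cos_add, Real.cos_sub, sub_zero]
    ring
  simp_rw [h]
  rw [intervalIntegral_integral_mul_cos_swap m (by fun_prop) (C := 4) (fun x => ?_) ha]
  · refine integral_nonneg fun x => mul_nonneg ?_ (triangleKernel_nonneg _ _)
    linarith [Real.cos_le_one (b * x)]
  · have h1 := Real.cos_le_one (b * x)
    have h2 := Real.neg_one_le_cos (b * x)
    rw [abs_le]
    constructor <;> linarith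

lemma measureReal_closedBall_mul_le (m : Measure ℝ) [IsFiniteMeasure m]
    (him : ∀ u, (charFun m u).im = 0) (hnn : ∀ u, 0 ≤ cosTransform m u) {a : ℝ}
    (ha : 0 < a) (y : ℝ) :
    a ^ 2 / 5 * m.real (Metric.closedBall y a⁻¹) ≤ a * ∫ v in 0..a, cosTransform m v := by
  have hF := continuous_cosTransform m
  have h1 : ∀ v, ∫ x, 1 * Real.cos (v * (x - y)) ∂m ≤ cosTransform m v := by
    intro v
    have hI := integrable_exp_mul_I m v
    have hs : ∫ x, Real.sin (v * x) ∂m = 0 := by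
      rw [← him v, charFun_apply_real]
      refine Eq.trans (integral_congr_ae (ae_of_all _ fun x => ?_)) (integral_im hI)
      simp [← Complex.ofReal_mul, Complex.exp_ofReal_mul_I_im]
    have is : Integrable (fun x => Real.sin (v * x)) m :=
      Integrable.of_bound (by fun_prop) 1 (ae_of_all _ fun x => Real.abs_sin_le_one _)
    have e : ∫ x, 1 * Real.cos (v * (x - y)) ∂m
        = Real.cos (v * y) * cosTransform m v + Real.sin (v * y) * ∫ x, Real.sin (v * x) ∂m := by
      rw [cosTransform, ← integral_const_mul, ← integral_const_mul,
        ← integral_add ((integrable_cos_mul m v).const_mul _) (is.const_mul _)]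
      congr 1
      ext x
      rw [mul_sub, Real.cos_sub]
      ring
    rw [e, hs, mul_zero, add_zero]
    exact mul_le_of_le_one_left (hnn v) (Real.cos_le_one _)
  have h2 := intervalIntegral_integral_mul_cos_swap m (c := fun _ => 1) (y := y) (C := 1)
    continuous_const (by simp) ha.le
  have h3 : a ^ 2 / 5 * m.real (Metric.closedBall y a⁻¹)
      ≤ ∫ x, 1 * triangleKernel a (x - y) ∂m := by
    simp_rw [one_mul]
    refine le_trans ?_ (mul_meas_ge_le_integral_of_nonneg
      (ae_of_all _ fun x => triangleKernel_nonneg _ _)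
      (integrable_triangleKernel_sub m a y) (a ^ 2 / 5))
    refine mul_le_mul_of_nonneg_left (measureReal_mono fun x hx => ?_) (by positivity)
    refine sq_div_five_le_triangleKernel ?_
    rw [Metric.mem_closedBall, Real.dist_eq] at hx
    rw [abs_mul, abs_of_pos ha]
    calc a * |x - y| ≤ a * a⁻¹ := by gcongr
      _ = 1 := mul_inv_cancel₀ ha.ne'
  refine h3.trans ?_
  rw [← h2, ← intervalIntegral.integral_const_mul]
  have hc : Continuous fun v => ∫ x, 1 * Real.cos (v * (x - y)) ∂m :=
    continuous_of_dominated (bound := fun _ => 1) (fun u => by fun_prop)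
      (fun u => ae_of_all _ fun x => by simpa using Real.abs_cos_le_one _) (integrable_const _)
      (ae_of_all _ fun x => by fun_prop)
  refine intervalIntegral.integral_mono_on ha.le (Continuous.intervalIntegrable (by fun_prop) _ _)
    (Continuous.intervalIntegrable (by fun_prop) _ _) fun v hv => ?_
  calc _ ≤ (a - v) * cosTransform m v := mul_le_mul_of_nonneg_left (h1 v) (by linarith [hv.2])
    _ ≤ a * cosTransform m v := mul_le_mul_of_nonneg_right (by linarith [hv.1]) (hnn v)

/-- A finite measure with nonnegative integrable characteristic function is absolutely
continuous. -/
lemma absolutelyContinuous_of_cosTransform (m : Measure ℝ) [IsFiniteMeasure m]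
    (him : ∀ u, (charFun m u).im = 0) (hnn : ∀ u, 0 ≤ cosTransform m u) {C : ℝ}
    (hC : ∀ a, 0 < a → ∫ v in 0..a, cosTransform m v ≤ C) : m ≪ volume := by
  have hC0 : 0 ≤ C := (intervalIntegral.integral_nonneg zero_le_one fun v _ => hnn v).trans
    (hC 1 one_pos)
  have hball : ∀ y r : ℝ, 0 < r →
      m (Metric.closedBall y r) ≤ (ENNReal.ofReal (5 * C / 2) • volume) (Metric.closedBall y r) := by
    intro y r hr
    have h := measureReal_closedBall_mul_le m him hnn (inv_pos.mpr hr) y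
    have h' := hC r⁻¹ (inv_pos.mpr hr)
    rw [inv_inv] at h
    rw [Measure.smul_apply, Real.volume_closedBall, smul_eq_mul,
      ← ENNReal.ofReal_mul (by positivity), ← ofReal_measureReal]
    refine ENNReal.ofReal_le_ofReal ?_
    have h2 : r⁻¹ ^ 2 / 5 * m.real (Metric.closedBall y r) ≤ r⁻¹ * C :=
      h.trans (mul_le_mul_of_nonneg_left h' (by positivity))
    field_simp at h2
    linarith
  have hlf : IsLocallyFiniteMeasure (ENNReal.ofReal (5 * C / 2) • (volume : Measure ℝ)) := by
    rw [ENNReal.ofReal]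
    exact inferInstanceAs (IsLocallyFiniteMeasure (Real.toNNReal (5 * C / 2) • volume))
  have hle : ∀ s, m s ≤ (ENNReal.ofReal (5 * C / 2) • volume) s := fun s =>
    (Besicovitch.vitaliFamily m).measure_le_of_frequently_le _ Measure.AbsolutelyContinuous.rfl s
      fun x _ => (Besicovitch.tendsto_filterAt m x).frequently
        (Eventually.frequently (by
          filter_upwards [self_mem_nhdsWithin] with r hr using hball x r hr))
  intro s hs
  have := hle s
  rw [Measure.smul_apply, hs, smul_zero] at this
  exact le_antisymm this bot_le

/-- Comparison of the integrals over `[R, 3R/2]` and `[0, R/2]` of a function which is comparable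
to a nonnegative positive definite one. -/
lemma intervalIntegral_le_of_le_cosTransform (m : Measure ℝ) [IsFiniteMeasure m]
    (hm : ∀ u, 0 ≤ cosTransform m u) {f : ℝ → ℝ} (hf : Continuous f) {R A B : ℝ}
    (hR : 0 < R) (hA : 0 < A) (hB : 0 < B)
    (hfA : ∀ u ∈ Icc R (3 / 2 * R), f u ≤ A * cosTransform m u)
    (hfB : ∀ u ∈ Icc 0 (R / 2), B * cosTransform m u ≤ f u) :
    ∫ u in R..(3 / 2 * R), f u ≤ 4 * (A / B) * ∫ u in 0..(R / 2), f u := by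
  set g := cosTransform m with hg
  have hgc : Continuous g := continuous_cosTransform m
  have ii : ∀ (h : ℝ → ℝ) (_ : Continuous h) (a b : ℝ), IntervalIntegrable h volume a b :=
    fun h hh a b => hh.intervalIntegrable a b
  have e1 : ∫ u in R..(3 / 2 * R), f u ≤ A * ∫ u in R..(3 / 2 * R), g u := by
    rw [← intervalIntegral.integral_const_mul]
    exact intervalIntegral.integral_mono_on (by linarith) (ii _ hf _ _)
      (ii _ (by fun_prop) _ _) hfA
  have e2 : ∫ u in R..(3 / 2 * R), g u
      = ∫ v in 0..(R / 4), (g (5 / 4 * R + v) + g (5 / 4 * R - v)) := by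
    rw [intervalIntegral.integral_add (ii _ (by fun_prop) _ _) (ii _ (by fun_prop) _ _),
      intervalIntegral.integral_comp_add_left, intervalIntegral.integral_comp_sub_left,
      add_comm, show 5 / 4 * R + R / 4 = 3 / 2 * R by ring, add_zero, sub_zero,
      show 5 / 4 * R - R / 4 = R by ring,
      intervalIntegral.integral_add_adjacent_intervals (ii _ hgc _ _) (ii _ hgc _ _)]
  have e3 : R / 4 * ∫ v in 0..(R / 4), (g (5 / 4 * R + v) + g (5 / 4 * R - v))
      ≤ ∫ v in 0..(R / 4), (R / 2 - v) * (g (5 / 4 * R + v) + g (5 / 4 * R - v)) := by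
    rw [← intervalIntegral.integral_const_mul]
    refine intervalIntegral.integral_mono_on (by linarith) (ii _ (by fun_prop) _ _)
      (ii _ (by fun_prop) _ _) fun v hv => ?_
    exact mul_le_mul_of_nonneg_right (by linarith [hv.2]) (add_nonneg (hm _) (hm _))
  have e4 : ∫ v in 0..(R / 4), (R / 2 - v) * (g (5 / 4 * R + v) + g (5 / 4 * R - v))
      ≤ ∫ v in 0..(R / 2), (R / 2 - v) * (g (5 / 4 * R + v) + g (5 / 4 * R - v)) := by
    rw [← intervalIntegral.integral_add_adjacent_intervals (b := R / 4) (c := R / 2)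
      (ii _ (by fun_prop) _ _) (ii _ (by fun_prop) _ _)]
    refine le_add_of_nonneg_right (intervalIntegral.integral_nonneg (by linarith) fun v hv => ?_)
    exact mul_nonneg (by linarith [hv.2]) (add_nonneg (hm _) (hm _))
  have e5 := intervalIntegral_shift_cosTransform_le m (a := R / 2) (by linarith) (5 / 4 * R)
  have e6 : ∫ v in 0..(R / 2), (R / 2 - v) * (2 * g v) ≤ R * ∫ v in 0..(R / 2), g v := by
    rw [← intervalIntegral.integral_const_mul]
    refine intervalIntegral.integral_mono_on (by linarith) (ii _ (by fun_prop) _ _)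
      (ii _ (by fun_prop) _ _) fun v hv => ?_
    nlinarith [mul_nonneg hv.1 (hm v)]
  have e7 : B * ∫ v in 0..(R / 2), g v ≤ ∫ v in 0..(R / 2), f v := by
    rw [← intervalIntegral.integral_const_mul]
    exact intervalIntegral.integral_mono_on (by linarith) (ii _ (by fun_prop) _ _)
      (ii _ hf _ _) hfB
  have e8 : ∫ u in R..(3 / 2 * R), g u ≤ 4 * ∫ v in 0..(R / 2), g v := by
    rw [e2]
    have := (e3.trans e4).trans (e5.trans e6)
    refine le_of_mul_le_mul_left ?_ (show 0 < R / 4 by linarith)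
    linarith
  have e9 : ∫ v in 0..(R / 2), g v ≤ (∫ v in 0..(R / 2), f v) / B := by
    rw [le_div_iff₀ hB]
    linarith
  calc _ ≤ A * (4 * ((∫ v in 0..(R / 2), f v) / B)) :=
        e1.trans (mul_le_mul_of_nonneg_left (e8.trans (by linarith)) hA.le)
    _ = _ := by ring

lemma integrable_min_one_sq {ν : Measure ℝ}
    (hlevy : ∫⁻ x, ENNReal.ofReal (min 1 (x ^ 2)) ∂ν < ⊤) :
    Integrable (fun x : ℝ => min 1 (x ^ 2)) ν := by
  refine ⟨by fun_prop, ?_⟩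
  rw [hasFiniteIntegral_iff_ofReal (ae_of_all _ fun x => by positivity)]
  exact hlevy

lemma integrable_cos_sub_one {ν : Measure ℝ}
    (hlevy : ∫⁻ x, ENNReal.ofReal (min 1 (x ^ 2)) ∂ν < ⊤) (u : ℝ) :
    Integrable (fun x : ℝ => Real.cos (u * x) - 1) ν := by
  refine ((integrable_min_one_sq hlevy).const_mul (2 + u ^ 2)).mono' (by fun_prop)
    (ae_of_all _ fun x => ?_)
  have h1 := Real.cos_le_one (u * x)
  have h2 := Real.neg_one_le_cos (u * x)
  have h3 := Real.one_sub_sq_div_two_le_cos (x := u * x)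
  rw [Real.norm_eq_abs, abs_of_nonpos (by linarith)]
  rcases min_choice 1 (x ^ 2) with h | h <;> rw [h]
  · nlinarith [sq_nonneg u]
  · nlinarith [sq_nonneg x, sq_nonneg (u * x)]

lemma integrableOn_sq {ν : Measure ℝ}
    (hlevy : ∫⁻ x, ENNReal.ofReal (min 1 (x ^ 2)) ∂ν < ⊤) (r : ℝ) :
    IntegrableOn (fun x : ℝ => x ^ 2) (Icc (-r) r) ν := by
  refine ((integrable_min_one_sq hlevy).integrableOn.const_mul (1 + r ^ 2)).mono'
    (by fun_prop) ?_
  filter_upwards [ae_restrict_mem measurableSet_Icc] with x hx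
  have h : x ^ 2 ≤ r ^ 2 := sq_le_sq' hx.1 hx.2
  rw [Real.norm_of_nonneg (sq_nonneg x)]
  rcases min_choice 1 (x ^ 2) with h' | h' <;> rw [h'] <;> nlinarith [sq_nonneg x, sq_nonneg r]

lemma isFiniteMeasure_restrict_compl_Icc {ν : Measure ℝ}
    (hlevy : ∫⁻ x, ENNReal.ofReal (min 1 (x ^ 2)) ∂ν < ⊤) {r : ℝ} (hr : 0 < r) :
    IsFiniteMeasure (ν.restrict (Icc (-r) r)ᶜ) := by
  constructor
  rw [Measure.restrict_apply_univ]
  refine lt_of_le_of_lt (measure_mono fun x hx => ?_)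
    ((integrable_min_one_sq hlevy).measure_ge_lt_top (show 0 < min 1 (r ^ 2) by positivity))
  rw [mem_ofPred_eq]
  refine min_le_min_left 1 (le_of_not_ge fun h => hx ?_)
  exact abs_le_of_sq_le_sq' h hr.le

lemma map_neg_restrict_compl_Icc {ν : Measure ℝ} (hsym : ν.map (fun x => -x) = ν) (r : ℝ) :
    (ν.restrict (Icc (-r) r)ᶜ).map (fun x => -x) = ν.restrict (Icc (-r) r)ᶜ := by
  have h : (fun x : ℝ => -x) ⁻¹' (Icc (-r) r)ᶜ = (Icc (-r) r)ᶜ := by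
    ext x
    simp only [mem_preimage, mem_compl_iff, mem_Icc, neg_le_neg_iff, neg_le, and_comm]
  conv_rhs => rw [← hsym, Measure.restrict_map (by fun_prop) measurableSet_Icc.compl, h]

lemma setIntegral_cos_sub_one_bounds {ν : Measure ℝ}
    (hlevy : ∫⁻ x, ENNReal.ofReal (min 1 (x ^ 2)) ∂ν < ⊤) {u r : ℝ} (hur : |u| * r ≤ 3) :
    -(u ^ 2 / 2 * ∫ x in Icc (-r) r, x ^ 2 ∂ν) ≤ ∫ x in Icc (-r) r, (Real.cos (u * x) - 1) ∂ν ∧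
    ∫ x in Icc (-r) r, (Real.cos (u * x) - 1) ∂ν ≤ -(u ^ 2 / 5 * ∫ x in Icc (-r) r, x ^ 2 ∂ν) := by
  have hc := (integrable_cos_sub_one hlevy u).integrableOn (s := Icc (-r) r)
  have hs := integrableOn_sq hlevy r
  simp_rw [← integral_const_mul, ← integral_neg]
  constructor
  · refine setIntegral_mono_on (hs.const_mul _).neg hc measurableSet_Icc fun x _ => ?_
    nlinarith [Real.one_sub_sq_div_two_le_cos (x := u * x)]
  · refine setIntegral_mono_on hc (hs.const_mul _).neg measurableSet_Icc fun x hx => ?_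
    have hx' : |u * x| ≤ 3 := by
      rw [abs_mul]
      exact (mul_le_mul_of_nonneg_left (abs_le.mpr hx) (abs_nonneg u)).trans hur
    have h1 := cos_le_one_sub_sq_div_five (x := u * x) (by linarith)
    nlinarith

/-- Growth of the integral of the characteristic function `exp (∫ (cos (u x) - 1) dν)`. -/
lemma intervalIntegral_exp_integral_cos_sub_one_le {ν : Measure ℝ}
    (hsym : ν.map (fun x => -x) = ν)
    (hlevy : ∫⁻ x, ENNReal.ofReal (min 1 (x ^ 2)) ∂ν < ⊤) {f : ℝ → ℝ} (hf : Continuous f)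
    (hfν : ∀ u, f u = Real.exp (∫ x, (Real.cos (u * x) - 1) ∂ν)) {R : ℝ} (hR : 0 < R) :
    ∫ u in R..(3 / 2 * R), f u ≤
      4 * Real.exp (-(3 / 40 * (R ^ 2 * ∫ x in Icc (-R⁻¹) R⁻¹, x ^ 2 ∂ν)))
        * ∫ u in 0..(R / 2), f u := by
  set r := R⁻¹ with hr
  have hr0 : 0 < r := inv_pos.mpr hR
  have hRr : R * r = 1 := mul_inv_cancel₀ hR.ne'
  set V := ∫ x in Icc (-r) r, x ^ 2 ∂ν with hV
  have hV0 : 0 ≤ V := integral_nonneg fun x => sq_nonneg x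
  have hfin := isFiniteMeasure_restrict_compl_Icc hlevy hr0
  obtain ⟨m, hm, hmexp⟩ := exists_cosTransform_eq_exp _ (map_neg_restrict_compl_Icc hsym r)
  set n := ν.restrict (Icc (-r) r)ᶜ with hn
  set K := Real.exp (-n.real univ) with hK
  have hfeq : ∀ u, f u = Real.exp (∫ x in Icc (-r) r, (Real.cos (u * x) - 1) ∂ν) * K
      * cosTransform m u := by
    intro u
    rw [hfν, hmexp, hK, ← Real.exp_add, ← Real.exp_add,
      ← integral_add_compl measurableSet_Icc (integrable_cos_sub_one hlevy u),
      integral_sub (integrable_cos_mul n u) (integrable_const _)]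
    simp only [cosTransform, integral_const, smul_eq_mul, mul_one]
    congr 1
    ring
  have hmpos : ∀ u, 0 ≤ cosTransform m u := fun u => by rw [hmexp]; positivity
  have key := intervalIntegral_le_of_le_cosTransform m hmpos hf hR
    (A := Real.exp (-(R ^ 2 / 5 * V)) * K) (B := Real.exp (-(R ^ 2 / 8 * V)) * K)
    (by positivity) (by positivity) ?_ ?_
  · refine key.trans_eq ?_
    rw [mul_div_mul_right _ _ (Real.exp_pos _).ne', ← Real.exp_sub]
    congr 3
    ring
  · intro u hu
    have hu0 : 0 ≤ u := hR.le.trans hu.1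
    have hb := (setIntegral_cos_sub_one_bounds (r := r) hlevy (u := u) (by
      rw [abs_of_nonneg hu0]; nlinarith [mul_le_mul_of_nonneg_right hu.2 hr0.le])).2
    rw [hfeq]
    refine mul_le_mul_of_nonneg_right (mul_le_mul_of_nonneg_right (Real.exp_le_exp.mpr
      (hb.trans ?_)) (Real.exp_pos _).le) (hmpos u)
    have : R ^ 2 ≤ u ^ 2 := pow_le_pow_left₀ hR.le hu.1 2
    nlinarith [mul_le_mul_of_nonneg_right this hV0]
  · intro u hu
    have hb := (setIntegral_cos_sub_one_bounds (r := r) hlevy (u := u) (by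
      rw [abs_of_nonneg hu.1]; nlinarith [mul_le_mul_of_nonneg_right hu.2 hr0.le])).1
    rw [hfeq]
    refine mul_le_mul_of_nonneg_right (mul_le_mul_of_nonneg_right (Real.exp_le_exp.mpr
      (le_trans ?_ hb)) (Real.exp_pos _).le) (hmpos u)
    have : u ^ 2 ≤ (R / 2) ^ 2 := pow_le_pow_left₀ hu.1 hu.2 2
    nlinarith [mul_le_mul_of_nonneg_right this hV0]

/-- Geometric sums of `r ^ 2 / η r` are controlled by the integral of `r / η r`. -/
lemma sum_sq_div_le_setIntegral {η : ℝ → ℝ} (hpos : ∀ r > (0 : ℝ), 0 < η r)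
    (hmono : ∀ r s : ℝ, 0 < r → r ≤ s → η r ≤ η s)
    (hint : IntegrableOn (fun r => r / η r) (Ioo (0 : ℝ) 1) volume) (N : ℕ) :
    ∑ k ∈ Finset.range N, ((2 / 3 : ℝ) ^ k) ^ 2 / η ((2 / 3) ^ k)
      ≤ 9 / 2 * ∫ r in Ioo (0 : ℝ) 1, r / η r := by
  have hIoc : IntegrableOn (fun r => r / η r) (Ioc (0 : ℝ) 1) volume := by
    rwa [integrableOn_Ioc_iff_integrableOn_Ioo]
  have hp : ∀ k : ℕ, 0 < (2 / 3 : ℝ) ^ k := fun k => by positivity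
  have hle1 : ∀ k : ℕ, (2 / 3 : ℝ) ^ k ≤ 1 := fun k => pow_le_one₀ (by norm_num) (by norm_num)
  have hanti : ∀ k : ℕ, (2 / 3 : ℝ) ^ (k + 1) ≤ (2 / 3) ^ k := fun k => by
    rw [pow_succ]; linarith [hp k]
  have hii : ∀ a b : ℝ, 0 < a → a ≤ b → b ≤ 1 →
      IntervalIntegrable (fun r => r / η r) volume a b := fun a b ha hab hb =>
    (intervalIntegrable_iff_integrableOn_Ioc_of_le hab).mpr
      (hIoc.mono_set (Ioc_subset_Ioc ha.le hb))
  have hterm : ∀ k : ℕ, ((2 / 3 : ℝ) ^ k) ^ 2 / η ((2 / 3) ^ k)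
      ≤ 9 / 2 * ∫ r in ((2 / 3 : ℝ) ^ (k + 1))..((2 / 3) ^ k), r / η r := by
    intro k
    have h := intervalIntegral.integral_mono_on (hanti k)
      (intervalIntegrable_const (c := (2 / 3 : ℝ) ^ (k + 1) / η ((2 / 3) ^ k)))
      (hii _ _ (hp _) (hanti k) (hle1 k)) fun r hr =>
        div_le_div₀ ((hp _).le.trans hr.1) hr.1 (hpos r ((hp _).trans_le hr.1))
          (hmono r _ ((hp _).trans_le hr.1) hr.2)
    rw [intervalIntegral.integral_const, smul_eq_mul] at h
    refine le_trans (le_of_eq ?_) (mul_le_mul_of_nonneg_left h (by norm_num))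
    rw [pow_succ]
    ring
  have hsum : ∀ N : ℕ, ∑ k ∈ Finset.range N, ((2 / 3 : ℝ) ^ k) ^ 2 / η ((2 / 3) ^ k)
      ≤ 9 / 2 * ∫ r in ((2 / 3 : ℝ) ^ N)..1, r / η r := by
    intro N
    induction N with
    | zero => simp
    | succ N ih =>
      rw [Finset.sum_range_succ, ← intervalIntegral.integral_add_adjacent_intervals
        (hii _ _ (hp (N + 1)) (hanti N) (hle1 N)) (hii _ _ (hp N) (hle1 N) le_rfl)]
      linarith [hterm N]
  refine (hsum N).trans (mul_le_mul_of_nonneg_left ?_ (by norm_num))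
  rw [intervalIntegral.integral_of_le (hle1 N), ← integral_Ioc_eq_integral_Ioo]
  refine setIntegral_mono_set hIoc ?_ (Ioc_subset_Ioc (hp N).le le_rfl).eventuallyLE
  filter_upwards [ae_restrict_mem measurableSet_Ioc] with r hr
  exact div_nonneg hr.1.le (hpos r hr.1).le

/-- Main theorem: an infinitely divisible distribution with characteristics `(0,0,ν)`,
where `ν` is a symmetric Lévy measure charging every interval `(0,ε)` and with
`η(r) = ∫_{(0,r]} x² dν` satisfying `∫_0^1 r/η(r) dr < ∞`, is absolutely continuous
with respect to Lebesgue measure. -/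
theorem stmt_8 (ν : Measure ℝ) (η : ℝ → ℝ) (μ : Measure ℝ) [IsProbabilityMeasure μ]
    (hν0 : ν {0} = 0)
    (hsym : ν.map (fun x => -x) = ν)
    (hlevy : ∫⁻ x, ENNReal.ofReal (min 1 (x ^ 2)) ∂ν < ⊤)
    (hcharge : ∀ ε > (0:ℝ), 0 < ν (Set.Ioo 0 ε))
    (hη : ∀ r > (0:ℝ), η r = ∫ x in Set.Ioc (0:ℝ) r, x ^ 2 ∂ν)
    (hηpos : ∀ r > (0:ℝ), 0 < η r)
    (hint : IntegrableOn (fun r => r / η r) (Set.Ioo (0:ℝ) 1) volume)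
    (hchar : ∀ u : ℝ,
      ∫ x, Complex.exp (u * x * Complex.I) ∂μ
        = Complex.exp ((∫ x, (Real.cos (u * x) - 1) ∂ν : ℝ))) :
    μ ≪ (volume : Measure ℝ) := by
  have hφ : ∀ u, charFun μ u = ((Real.exp (∫ x, (Real.cos (u * x) - 1) ∂ν) : ℝ) : ℂ) := fun u => by
    rw [charFun_apply_real, hchar u, Complex.ofReal_exp]
  have hf : ∀ u, cosTransform μ u = Real.exp (∫ x, (Real.cos (u * x) - 1) ∂ν) := fun u => by
    rw [← re_charFun_eq_cosTransform, hφ, Complex.ofReal_re]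
  have hf0 : ∀ u, 0 ≤ cosTransform μ u := fun u => by rw [hf]; positivity
  have hfc := continuous_cosTransform μ
  have hIoc : ∀ r : ℝ, 0 < r → Ioc 0 r ⊆ Icc (-r) r := fun r hr x hx =>
    ⟨by linarith [hx.1], hx.2⟩
  have hmono : ∀ r s : ℝ, 0 < r → r ≤ s → η r ≤ η s := fun r s hr hrs => by
    rw [hη r hr, hη s (hr.trans_le hrs)]
    exact setIntegral_mono_set ((integrableOn_sq hlevy s).mono_set (hIoc s (hr.trans_le hrs)))
      (ae_of_all _ fun x => sq_nonneg x) (Ioc_subset_Ioc_right hrs).eventuallyLE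
  have hηV : ∀ r : ℝ, 0 < r → η r ≤ ∫ x in Icc (-r) r, x ^ 2 ∂ν := fun r hr => by
    rw [hη r hr]
    exact setIntegral_mono_set (integrableOn_sq hlevy r)
      (ae_of_all _ fun x => sq_nonneg x) (hIoc r hr).eventuallyLE
  have ii : ∀ a b : ℝ, IntervalIntegrable (cosTransform μ) volume a b :=
    fun a b => hfc.intervalIntegrable a b
  have hI0 : ∀ a : ℝ, 0 ≤ a → 0 ≤ ∫ u in 0..a, cosTransform μ u := fun a ha =>
    intervalIntegral.integral_nonneg ha fun u _ => hf0 u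
  have hImono : ∀ a b : ℝ, a ≤ b →
      ∫ u in 0..a, cosTransform μ u ≤ ∫ u in 0..b, cosTransform μ u := fun a b hab => by
    rw [← intervalIntegral.integral_add_adjacent_intervals (ii 0 a) (ii a b)]
    exact le_add_of_nonneg_right (intervalIntegral.integral_nonneg hab fun u _ => hf0 u)
  have hstep : ∀ k : ℕ, ∫ u in 0..((3 / 2 : ℝ) ^ (k + 1)), cosTransform μ u
      ≤ Real.exp (80 * (((2 / 3 : ℝ) ^ k) ^ 2 / η ((2 / 3) ^ k)))
        * ∫ u in 0..((3 / 2 : ℝ) ^ k), cosTransform μ u := by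
    intro k
    have hR : (0 : ℝ) < (3 / 2) ^ k := by positivity
    have hinv : ((3 / 2 : ℝ) ^ k)⁻¹ = (2 / 3) ^ k := by rw [← inv_pow]; norm_num
    have h := intervalIntegral_exp_integral_cos_sub_one_le hsym hlevy hfc hf hR
    have hV := hηV _ (inv_pos.mpr hR)
    have hη0 := hηpos _ (inv_pos.mpr hR)
    rw [← hinv]
    set R := (3 / 2 : ℝ) ^ k with hRdef
    set V := ∫ x in Icc (-R⁻¹) R⁻¹, x ^ 2 ∂ν
    have hw : 0 < R ^ 2 * η R⁻¹ := by positivity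
    have hexp : 4 * Real.exp (-(3 / 40 * (R ^ 2 * V))) ≤ 80 * (R⁻¹ ^ 2 / η R⁻¹) := by
      have h1 : R⁻¹ ^ 2 / η R⁻¹ = (R ^ 2 * η R⁻¹)⁻¹ := by
        rw [inv_pow, mul_inv, div_eq_mul_inv]
      have h2 : 3 / 40 * (R ^ 2 * η R⁻¹) ≤ Real.exp (3 / 40 * (R ^ 2 * V)) := by
        have := Real.add_one_le_exp (3 / 40 * (R ^ 2 * V))
        nlinarith [mul_le_mul_of_nonneg_left hV (sq_nonneg R)]
      rw [h1, Real.exp_neg]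
      have h3 := inv_anti₀ (by positivity) h2
      rw [mul_inv (3 / 40 : ℝ), inv_div] at h3
      have h4 : 0 < (R ^ 2 * η R⁻¹)⁻¹ := inv_pos.mpr hw
      linarith
    rw [pow_succ', ← hRdef, ← intervalIntegral.integral_add_adjacent_intervals (ii 0 R) (ii R _)]
    have h5 := hImono (R / 2) R (by linarith)
    have h6 := hI0 (R / 2) (by linarith)
    have h7 := hI0 R hR.le
    have h8 := Real.add_one_le_exp (80 * (R⁻¹ ^ 2 / η R⁻¹))
    calc _ ≤ (∫ u in 0..R, cosTransform μ u)
          + 80 * (R⁻¹ ^ 2 / η R⁻¹) * ∫ u in 0..R, cosTransform μ u :=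
        add_le_add le_rfl (h.trans (mul_le_mul hexp h5 h6 (by positivity)))
      _ = (80 * (R⁻¹ ^ 2 / η R⁻¹) + 1) * ∫ u in 0..R, cosTransform μ u := by ring
      _ ≤ _ := mul_le_mul_of_nonneg_right h8 h7
  have hbound : ∀ N : ℕ, ∫ u in 0..((3 / 2 : ℝ) ^ N), cosTransform μ u
      ≤ Real.exp (80 * ∑ k ∈ Finset.range N, ((2 / 3 : ℝ) ^ k) ^ 2 / η ((2 / 3) ^ k))
        * ∫ u in 0..1, cosTransform μ u := by
    intro N
    induction N with
    | zero => simp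
    | succ N ih =>
      refine (hstep N).trans ((mul_le_mul_of_nonneg_left ih (Real.exp_pos _).le).trans_eq ?_)
      rw [← mul_assoc, ← Real.exp_add, Finset.sum_range_succ]
      congr 2
      ring
  refine absolutelyContinuous_of_cosTransform μ (fun u => by rw [hφ, Complex.ofReal_im]) hf0
    (C := Real.exp (80 * (9 / 2 * ∫ r in Ioo (0 : ℝ) 1, r / η r))
      * ∫ u in 0..1, cosTransform μ u) fun a _ => ?_
  obtain ⟨N, hN⟩ := pow_unbounded_of_one_lt a (show (1 : ℝ) < 3 / 2 by norm_num)
  refine (hImono a _ hN.le).trans ((hbound N).trans (mul_le_mul_of_nonneg_right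
    (Real.exp_le_exp.mpr ?_) (hI0 1 zero_le_one)))
  exact mul_le_mul_of_nonneg_left (sum_sq_div_le_setIntegral hηpos hmono hint N) (by norm_num)
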